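/- arXiv:1801.07745 — 4 statements merged into one kernel-verified Lean document; each statement's English description precedes it below -/
import Mathlib

section
/- Let μ and ν be Borel probability measures on ℝⁿ, each with finite first moment (∫‖x‖ dμ < ∞ and ∫‖y‖ dν < ∞). Then the 1-Wasserstein distance equals its Kantorovich–Rubinstein dual: the infimum over all couplings π of μ and ν of ∫_{ℝⁿ×ℝⁿ} ‖x − y‖ dπ(x,y) equals the supremum, over all 1-Lipschitz functions ψ : ℝⁿ → ℝ that are integrable with respect to both μ and ν, of ∫ ψ dν − ∫ ψ dμ. -/
open MeasureTheory

lemma kr_fin {X ι κ : Type*} [NormedAddCommGroup X] [Fintype ι] [Fintype κ] 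
    (x : ι → X) (y : κ → X) (p : ι → ℝ) (q : κ → ℝ)
    (hp : ∀ i, 0 ≤ p i) (hq : ∀ j, 0 ≤ q j) (hp1 : ∑ i, p i = 1) (hq1 : ∑ j, q j = 1) (C : ℝ)
    (hC : ∀ ψ : X → ℝ, (∀ a b, |ψ a - ψ b| ≤ ‖a - b‖) →
      ∑ j, q j * ψ (y j) - ∑ i, p i * ψ (x i) ≤ C) :
    ∃ w : ι × κ → ℝ, (∀ z, 0 ≤ w z) ∧ (∀ i, ∑ j, w (i, j) = p i) ∧ (∀ j, ∑ i, w (i, j) = q j) ∧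
      ∑ i, ∑ j, w (i, j) * ‖x i - y j‖ ≤ C := by
  classical
  have hne : Nonempty ι := by
    by_contra h
    rw [not_nonempty_iff] at h
    simp at hp1
  let L : (ι × κ → ℝ) →ₗ[ℝ] ((ι → ℝ) × (κ → ℝ) × ℝ) :=
    { toFun := fun w => (fun i => ∑ j, w (i, j), fun j => ∑ i, w (i, j),
        ∑ i, ∑ j, w (i, j) * ‖x i - y j‖)
      map_add' := by
        intro a b
        ext <;> simp [Finset.sum_add_distrib, add_mul]
      map_smul' := by
        intro c b
        ext <;> simp [Finset.mul_sum, mul_assoc] }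
  let K := L '' stdSimplex ℝ (ι × κ)
  let T : Set ((ι → ℝ) × (κ → ℝ) × ℝ) := {p} ×ˢ ({q} ×ˢ Set.Iic C)
  by_cases hKT : Disjoint K T
  · exfalso
    have hKc : Convex ℝ K := (convex_stdSimplex ℝ _).linear_image L
    have hKk : IsCompact K := (isCompact_stdSimplex ℝ _).image L.continuous_of_finiteDimensional
    have hTc : Convex ℝ T := (convex_singleton p).prod ((convex_singleton q).prod (convex_Iic C))
    have hTk : IsClosed T := isClosed_singleton.prod (isClosed_singleton.prod isClosed_Iic)
    obtain ⟨f, u, v, hfu, huv, hfv⟩ := geometric_hahn_banach_compact_closed hKc hKk hTc hTk hKT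
    let a : ι → ℝ := fun i => f (Pi.single i 1, 0, 0)
    let b : κ → ℝ := fun j => f (0, Pi.single j 1, 0)
    let t : ℝ := f (0, 0, 1)
    have e1 : ∀ i, (Pi.single i 1 : ι → ℝ) = fun j => if i = j then 1 else 0 := by
      intro i; ext j; simp [Pi.single_apply, eq_comm]
    have e2 : ∀ i, (Pi.single i 1 : κ → ℝ) = fun j => if i = j then 1 else 0 := by
      intro i; ext j; simp [Pi.single_apply, eq_comm]
    have hf : ∀ r s c, f (r, s, c) = ∑ i, r i * a i + ∑ j, s j * b j + c * t := by
      intro r s c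
      have h1 : f (r, 0, 0) = ∑ i, r i * a i := by
        have := LinearMap.pi_apply_eq_sum_univ
          (f.toLinearMap ∘ₗ LinearMap.inl ℝ (ι → ℝ) ((κ → ℝ) × ℝ)) r
        simp only [a, e1]; exact this
      have h2 : f (0, s, 0) = ∑ i, s i * b i := by
        have := LinearMap.pi_apply_eq_sum_univ
          (f.toLinearMap ∘ₗ LinearMap.inr ℝ (ι → ℝ) ((κ → ℝ) × ℝ) ∘ₗ LinearMap.inl ℝ (κ → ℝ) ℝ) s
        simp only [b, e2]; exact this
      have h3 : f (0, 0, c) = c * t := by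
        have := f.map_smul c (0, 0, 1)
        simpa [t] using this
      have : ((r, s, c) : (ι → ℝ) × (κ → ℝ) × ℝ) = (r, 0, 0) + (0, s, 0) + (0, 0, c) := by simp
      rw [this, map_add, map_add, h1, h2, h3]
    have hT : ∀ c ≤ C, v < ∑ i, p i * a i + ∑ j, q j * b j + c * t := by
      intro c hc
      rw [← hf]
      exact hfv _ (by simp [T, hc])
    have ht : t ≤ 0 := by
      by_contra! h
      set A := ∑ i, p i * a i + ∑ j, q j * b j
      have := hT (min C ((v - A) / t)) (min_le_left _ _)
      have h2 : min C ((v - A) / t) * t ≤ (v - A) / t * t := by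
        gcongr; exact min_le_right _ _
      rw [div_mul_cancel₀ _ h.ne'] at h2
      linarith
    have hpt : ∀ i j, a i + b j + ‖x i - y j‖ * t < u := by
      intro i j
      have := hfu (L (Pi.single (i, j) 1)) ⟨_, single_mem_stdSimplex ℝ _, rfl⟩
      have e : L (Pi.single (i, j) 1) = (Pi.single i 1, Pi.single j 1, ‖x i - y j‖) := by
        simp only [L, LinearMap.coe_mk, AddHom.coe_mk, Prod.mk.injEq]
        refine ⟨?_, ?_, ?_⟩
        · ext k
          by_cases hk : k = i <;> simp [Pi.single_apply, hk]
        · ext k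
          by_cases hk : k = j <;> simp [Pi.single_apply, hk]
        · rw [Finset.sum_eq_single i, Finset.sum_eq_single j] <;> simp +contextual [Pi.single_apply]
      rw [e, hf] at this
      simpa [Pi.single_apply] using this
    have hTC := hT C le_rfl
    rcases ht.eq_or_lt with h0 | h0
    · have h1 : ∑ i, p i * a i + ∑ j, q j * b j ≤ u := by
        have : ∑ i, ∑ j, p i * q j * (a i + b j) ≤ ∑ i, ∑ j, p i * q j * u := by
          gcongr with i _ j _
          · exact mul_nonneg (hp i) (hq j)
          · have := hpt i j
            rw [h0] at this; linarith
        have e1 : ∑ i, ∑ j, p i * q j * u = u := by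
          simp_rw [← Finset.sum_mul, ← Finset.mul_sum, hq1, mul_one, hp1, one_mul]
        have e2 : ∑ i, ∑ j, p i * q j * (a i + b j) = ∑ i, p i * a i + ∑ j, q j * b j := by
          simp_rw [mul_add, Finset.sum_add_distrib]
          congr 1
          · refine Finset.sum_congr rfl fun i _ => ?_
            rw [← Finset.sum_mul, ← Finset.mul_sum, hq1, mul_one]
          · rw [Finset.sum_comm]
            refine Finset.sum_congr rfl fun i _ => ?_
            rw [← Finset.sum_mul, ← Finset.sum_mul, hp1, one_mul]
        linarith
      rw [h0] at hTC
      linarith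
    · let ψ : X → ℝ := fun z => Finset.univ.inf' Finset.univ_nonempty
        (fun i => ‖x i - z‖ * (-t) - a i)
      have hψ1 : ∀ z z', ψ z ≤ ψ z' + ‖z - z'‖ * (-t) := by
        intro z z'
        rw [← sub_le_iff_le_add]
        refine Finset.le_inf' _ _ fun i hi => ?_
        have h1 : ψ z ≤ ‖x i - z‖ * (-t) - a i := Finset.inf'_le _ hi
        have h2 : ‖x i - z‖ ≤ ‖x i - z'‖ + ‖z - z'‖ := by
          rw [norm_sub_rev z z']
          exact norm_sub_le_norm_sub_add_norm_sub _ _ _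
        nlinarith
      have hψx : ∀ i, ψ (x i) ≤ - a i := by
        intro i
        have h1 : ψ (x i) ≤ ‖x i - x i‖ * (-t) - a i := Finset.inf'_le _ (Finset.mem_univ i)
        simpa using h1
      have hψy : ∀ j, b j - u ≤ ψ (y j) := by
        intro j
        refine Finset.le_inf' _ _ fun i hi => ?_
        linarith [hpt i j]
      have := hC (fun z => ψ z / (-t)) (by
        intro z z'
        have h0' : 0 < -t := by linarith
        rw [← sub_div, abs_div, abs_of_pos h0', div_le_iff₀ h0', abs_le]
        have h1 := hψ1 z z'
        have h2 := hψ1 z' z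
        rw [norm_sub_rev z' z] at h2
        constructor <;> linarith)
      simp_rw [← mul_div_assoc, ← Finset.sum_div, ← sub_div] at this
      rw [div_le_iff₀ (by linarith)] at this
      have h1 : ∑ j, q j * (b j - u) ≤ ∑ j, q j * ψ (y j) := by
        gcongr with j _
        · exact hq j
        · exact hψy j
      have h2 : ∑ i, p i * ψ (x i) ≤ ∑ i, p i * (- a i) := by
        gcongr with j _
        · exact hp j
        · exact hψx j
      simp_rw [mul_sub, Finset.sum_sub_distrib, ← Finset.sum_mul, hq1] at h1
      simp_rw [mul_neg, Finset.sum_neg_distrib] at h2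
      linarith
  · rw [Set.not_disjoint_iff] at hKT
    obtain ⟨_, ⟨w, hw, rfl⟩, h1, h2, h3⟩ := hKT
    refine ⟨w, hw.1, fun i => congrFun h1 i, fun i => congrFun h2 i, h3⟩

lemma kr_restrict_sum {X : Type*} [MeasurableSpace X] {β : Type*} (S : SimpleFunc X β)
    (μ : Measure X) : ∑ i : S.range, μ.restrict (S ⁻¹' {(i : β)}) = μ := by
  ext s hs
  rw [Measure.finsetSum_apply]
  have := S.sum_range_measure_preimage_singleton (μ.restrict s)
  rw [Measure.restrict_apply_univ] at this
  rw [← this, ← Finset.sum_coe_sort S.range]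
  refine Finset.sum_congr rfl fun i _ => ?_
  rw [Measure.restrict_apply hs, Measure.restrict_apply (S.measurableSet_fiber _), Set.inter_comm]

lemma kr_integral_simple {X : Type*} [MeasurableSpace X] {β : Type*} (S : SimpleFunc X β)
    (μ : Measure X) [IsFiniteMeasure μ] (g : β → ℝ) :
    ∑ i : S.range, μ.real (S ⁻¹' {(i : β)}) * g i = ∫ x, g (S x) ∂μ := by
  have hae : ∀ i : S.range, (fun x => g (S x)) =ᵐ[μ.restrict (S ⁻¹' {(i : β)})] fun _ => g i := by
    intro i
    filter_upwards [ae_restrict_mem (S.measurableSet_fiber _)] with x hx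
    rw [Set.mem_preimage, Set.mem_singleton_iff] at hx
    rw [hx]
  conv_rhs => rw [← kr_restrict_sum S μ]
  rw [integral_finsetSum_measure]
  · refine Finset.sum_congr rfl fun i _ => ?_
    rw [integral_congr_ae (hae i)]
    simp
  · intro i _
    exact (integrable_const _).congr (hae i).symm

lemma kr_cond_smul {X : Type*} [MeasurableSpace X] 
    (μ : Measure X) [IsFiniteMeasure μ] (A : Set X) :
    μ A • ProbabilityTheory.cond μ A = μ.restrict A := by
  rw [ProbabilityTheory.cond, smul_smul]
  by_cases h : μ A = 0
  · rw [Measure.restrict_eq_zero.2 h]; simp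
  · rw [ENNReal.mul_inv_cancel h (measure_ne_top _ _), one_smul]

lemma kr_glue {X : Type*} [NormedAddCommGroup X] [MeasurableSpace X]
    (μ ν : Measure X) [IsProbabilityMeasure μ] [IsProbabilityMeasure ν] (S R : SimpleFunc X X)
    (w : S.range × R.range → ℝ) (hw : ∀ z, 0 ≤ w z)
    (h1 : ∀ i, ∑ j, w (i, j) = μ.real (S ⁻¹' {(i : X)}))
    (h2 : ∀ j, ∑ i, w (i, j) = ν.real (R ⁻¹' {(j : X)})) :
    ∃ π : Measure (X × X), π.map Prod.fst = μ ∧ π.map Prod.snd = ν ∧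
      ∫ z, ‖S z.1 - R z.2‖ ∂π = ∑ i, ∑ j, w (i, j) * ‖(i : X) - j‖ := by
  let A : S.range → Set X := fun i => S ⁻¹' {(i : X)}
  let B : R.range → Set X := fun i => R ⁻¹' {(i : X)}
  have hA : ∀ i j, w (i, j) ≠ 0 → IsProbabilityMeasure (ProbabilityTheory.cond μ (A i)) := by
    intro i j h
    apply ProbabilityTheory.cond_isProbabilityMeasure
    intro h0
    have : ∑ j, w (i, j) = 0 := by rw [h1, measureReal_def]; simp only [A] at h0; simp [h0]
    rw [Finset.sum_eq_zero_iff_of_nonneg (fun _ _ => hw _)] at this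
    exact h (this j (Finset.mem_univ _))
  have hB : ∀ i j, w (i, j) ≠ 0 → IsProbabilityMeasure (ProbabilityTheory.cond ν (B j)) := by
    intro i j h
    apply ProbabilityTheory.cond_isProbabilityMeasure
    intro h0
    have : ∑ i, w (i, j) = 0 := by rw [h2, measureReal_def]; simp only [B] at h0; simp [h0]
    rw [Finset.sum_eq_zero_iff_of_nonneg (fun _ _ => hw _)] at this
    exact h (this i (Finset.mem_univ _))
  let P : S.range → R.range → Measure (X × X) := fun i j =>
    ENNReal.ofReal (w (i, j)) • (ProbabilityTheory.cond μ (A i)).prod (ProbabilityTheory.cond ν (B j))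
  have hP1 : ∀ i j, (P i j).map Prod.fst = ENNReal.ofReal (w (i, j)) • ProbabilityTheory.cond μ (A i) := by
    intro i j
    by_cases h : w (i, j) = 0
    · simp [P, h]
    · have := hB i j h
      simp only [P]
      rw [Measure.map_smul, Measure.map_fst_prod, measure_univ, one_smul]
  have hP2 : ∀ i j, (P i j).map Prod.snd = ENNReal.ofReal (w (i, j)) • ProbabilityTheory.cond ν (B j) := by
    intro i j
    by_cases h : w (i, j) = 0
    · simp [P, h]
    · have := hA i j h
      simp only [P]
      rw [Measure.map_smul, Measure.map_snd_prod, measure_univ, one_smul]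
  have hae : ∀ i j, (fun z : X × X => ‖S z.1 - R z.2‖) =ᵐ[P i j] fun _ => ‖(i : X) - j‖ := by
    intro i j
    apply Measure.ae_smul_measure
    have e1 : ∀ᵐ x ∂(ProbabilityTheory.cond μ (A i)), S x = i := by
      filter_upwards [ProbabilityTheory.ae_cond_mem (S.measurableSet_fiber _)] with x hx using hx
    have e2 : ∀ᵐ x ∂(ProbabilityTheory.cond ν (B j)), R x = j := by
      filter_upwards [ProbabilityTheory.ae_cond_mem (R.measurableSet_fiber _)] with x hx using hx
    filter_upwards [Measure.quasiMeasurePreserving_fst.ae e1,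
      Measure.quasiMeasurePreserving_snd.ae e2] with z hz1 hz2
    rw [hz1, hz2]
  have hfin : ∀ i j, IsFiniteMeasure (P i j) := fun i j => 
    Measure.smul_finite _ ENNReal.ofReal_ne_top
  have hint : ∀ i j, Integrable (fun z : X × X => ‖S z.1 - R z.2‖) (P i j) := fun i j =>
    (integrable_const _).congr (hae i j).symm
  refine ⟨∑ i, ∑ j, P i j, ?_, ?_, ?_⟩
  · rw [Measure.map_finset_sum measurable_fst.aemeasurable]
    conv_rhs => rw [← kr_restrict_sum S μ]
    refine Finset.sum_congr rfl fun i _ => ?_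
    rw [Measure.map_finset_sum measurable_fst.aemeasurable]
    simp_rw [hP1]
    rw [← Finset.sum_smul, ← ENNReal.ofReal_sum_of_nonneg (fun _ _ => hw _), h1,
      ofReal_measureReal, kr_cond_smul]
  · rw [Finset.sum_comm, Measure.map_finset_sum measurable_snd.aemeasurable]
    conv_rhs => rw [← kr_restrict_sum R ν]
    refine Finset.sum_congr rfl fun j _ => ?_
    rw [Measure.map_finset_sum measurable_snd.aemeasurable]
    simp_rw [hP2]
    rw [← Finset.sum_smul, ← ENNReal.ofReal_sum_of_nonneg (fun _ _ => hw _), h2,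
      ofReal_measureReal, kr_cond_smul]
  · rw [integral_finsetSum_measure (fun i _ => integrable_finsetSum_measure.2 fun j _ => hint i j)]
    refine Finset.sum_congr rfl fun i _ => ?_
    rw [integral_finsetSum_measure (fun j _ => hint i j)]
    refine Finset.sum_congr rfl fun j _ => ?_
    rw [integral_congr_ae (hae i j), integral_const, smul_eq_mul]
    congr 1
    by_cases h : w (i, j) = 0
    · simp [P, h]
    · have := hA i j h
      have := hB i j h
      simp [P, measureReal_def, hw]

lemma kr_approx {X : Type*} [NormedAddCommGroup X] [MeasurableSpace X] [BorelSpace X]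
    [SecondCountableTopology X] (μ : Measure X) [IsProbabilityMeasure μ]
    (hμ : Integrable (fun x => ‖x‖) μ) {ε : ℝ} (hε : 0 < ε) :
    ∃ S : SimpleFunc X X, Integrable (fun x => ‖x - S x‖) μ ∧ ∫ x, ‖x - S x‖ ∂μ ≤ ε := by
  have hid : Integrable (fun x : X => x) μ :=
    (integrable_norm_iff measurable_id.aestronglyMeasurable).1 hμ
  obtain ⟨S, hS, hS'⟩ := (memLp_one_iff_integrable.2 hid).exists_simpleFunc_eLpNorm_sub_lt
    ENNReal.one_ne_top (ε := ENNReal.ofReal ε) (by simpa using hε)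
  have hi : Integrable (fun x => x - S x) μ := hid.sub (memLp_one_iff_integrable.1 hS')
  refine ⟨S, hi.norm, ?_⟩
  rw [eLpNorm_one_eq_lintegral_enorm] at hS
  have := ofReal_integral_norm_eq_lintegral_enorm hi
  rw [← ENNReal.ofReal_le_ofReal_iff hε.le, this]
  exact hS.le

lemma kr_lip_int {X : Type*} [NormedAddCommGroup X] [MeasurableSpace X] [BorelSpace X]
    [SecondCountableTopology X] (μ : Measure X) [IsProbabilityMeasure μ]
    (hμ : Integrable (fun x => ‖x‖) μ) (ψ : X → ℝ) (hψ : ∀ a b, |ψ a - ψ b| ≤ ‖a - b‖) :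
    Integrable ψ μ := by
  have hc : Continuous ψ := by
    have : LipschitzWith 1 ψ := LipschitzWith.of_dist_le_mul fun a b => by
      simpa [dist_eq_norm, Real.dist_eq] using hψ a b
    exact this.continuous
  refine ((integrable_const |ψ 0|).add hμ).mono' hc.aestronglyMeasurable (ae_of_all _ fun x => ?_)
  have := hψ x 0
  rw [sub_zero] at this
  have h2 := abs_sub_abs_le_abs_sub (ψ x) (ψ 0)
  simp only [Real.norm_eq_abs, Pi.add_apply]
  linarith

lemma kr_simple_bound {X : Type*} [NormedAddCommGroup X] [MeasurableSpace X] [BorelSpace X]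
    [SecondCountableTopology X] (μ : Measure X) [IsProbabilityMeasure μ]
    (hμ : Integrable (fun x => ‖x‖) μ) (S : SimpleFunc X X)
    (hS : Integrable (fun x => ‖x - S x‖) μ) (ψ : X → ℝ) (hψ : ∀ a b, |ψ a - ψ b| ≤ ‖a - b‖) :
    |∫ x, ψ x ∂μ - ∫ x, ψ (S x) ∂μ| ≤ ∫ x, ‖x - S x‖ ∂μ := by
  have h2 : Integrable (fun x => ψ (S x)) μ := (S.map ψ).integrable_of_isFiniteMeasure
  rw [← integral_sub (kr_lip_int μ hμ ψ hψ) h2]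
  refine (abs_integral_le_integral_abs).trans ?_
  exact integral_mono ((kr_lip_int μ hμ ψ hψ).sub h2).abs hS fun x => hψ _ _

/-- Kantorovich–Rubinstein duality for the 1-Wasserstein distance on ℝⁿ. -/
theorem w1_kantorovich_rubinstein_duality
    (n : ℕ) (μ ν : Measure (EuclideanSpace ℝ (Fin n)))
    [IsProbabilityMeasure μ] [IsProbabilityMeasure ν]
    (hμ : Integrable (fun x => ‖x‖) μ) (hν : Integrable (fun y => ‖y‖) ν) :
    sInf {r : ℝ |
        ∃ π : Measure (EuclideanSpace ℝ (Fin n) × EuclideanSpace ℝ (Fin n)),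
          IsProbabilityMeasure π ∧ π.map Prod.fst = μ ∧ π.map Prod.snd = ν ∧
          r = ∫ p, ‖p.1 - p.2‖ ∂π}
      = sSup {r : ℝ |
        ∃ ψ : EuclideanSpace ℝ (Fin n) → ℝ,
          (∀ x y, |ψ x - ψ y| ≤ ‖x - y‖) ∧ Integrable ψ μ ∧ Integrable ψ ν ∧
          r = (∫ y, ψ y ∂ν) - ∫ x, ψ x ∂μ} := by
  set I := {r : ℝ |
        ∃ π : Measure (EuclideanSpace ℝ (Fin n) × EuclideanSpace ℝ (Fin n)),
          IsProbabilityMeasure π ∧ π.map Prod.fst = μ ∧ π.map Prod.snd = ν ∧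
          r = ∫ p, ‖p.1 - p.2‖ ∂π} with hI
  set D := {r : ℝ |
        ∃ ψ : EuclideanSpace ℝ (Fin n) → ℝ,
          (∀ x y, |ψ x - ψ y| ≤ ‖x - y‖) ∧ Integrable ψ μ ∧ Integrable ψ ν ∧
          r = (∫ y, ψ y ∂ν) - ∫ x, ψ x ∂μ} with hD
  have hfst : ∀ (π : Measure (EuclideanSpace ℝ (Fin n) × EuclideanSpace ℝ (Fin n))),
      π.map Prod.fst = μ → ∀ g : EuclideanSpace ℝ (Fin n) → ℝ, Integrable g μ →
      Integrable (fun p => g p.1) π ∧ ∫ p, g p.1 ∂π = ∫ x, g x ∂μ := by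
    rintro π rfl g hg
    exact ⟨hg.comp_measurable measurable_fst,
      (integral_map measurable_fst.aemeasurable hg.aestronglyMeasurable).symm⟩
  have hsnd : ∀ (π : Measure (EuclideanSpace ℝ (Fin n) × EuclideanSpace ℝ (Fin n))),
      π.map Prod.snd = ν → ∀ g : EuclideanSpace ℝ (Fin n) → ℝ, Integrable g ν →
      Integrable (fun p => g p.2) π ∧ ∫ p, g p.2 ∂π = ∫ x, g x ∂ν := by
    rintro π rfl g hg
    exact ⟨hg.comp_measurable measurable_snd,
      (integral_map measurable_snd.aemeasurable hg.aestronglyMeasurable).symm⟩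
  have hcost : ∀ (π : Measure (EuclideanSpace ℝ (Fin n) × EuclideanSpace ℝ (Fin n))),
      π.map Prod.fst = μ → π.map Prod.snd = ν → Integrable (fun p => ‖p.1 - p.2‖) π := by
    intro π h1 h2
    refine ((hfst π h1 _ hμ).1.add (hsnd π h2 _ hν).1).mono'
      (by fun_prop) (ae_of_all _ fun p => ?_)
    simpa using norm_sub_le p.1 p.2
  have hweak : ∀ r ∈ D, ∀ s ∈ I, r ≤ s := by
    rintro r ⟨ψ, hψ, hψμ, hψν, rfl⟩ s ⟨π, hπ, h1, h2, rfl⟩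
    obtain ⟨i1, e1⟩ := hfst π h1 ψ hψμ
    obtain ⟨i2, e2⟩ := hsnd π h2 ψ hψν
    rw [← e1, ← e2, ← integral_sub i2 i1]
    refine integral_mono (i2.sub i1) (hcost π h1 h2) fun p => ?_
    have := hψ p.2 p.1
    rw [norm_sub_rev] at this
    exact (le_abs_self _).trans this
  have hIne : I.Nonempty := ⟨_, μ.prod ν, inferInstance, by simp, by simp, rfl⟩
  have hDne : D.Nonempty := ⟨_, fun _ => 0, by simp, by simp, by simp, rfl⟩
  obtain ⟨s0, hs0⟩ := hIne
  obtain ⟨r0, hr0⟩ := hDne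
  have hIb : BddBelow I := ⟨r0, fun s hs => hweak _ hr0 _ hs⟩
  have hDb : BddAbove D := ⟨s0, fun r hr => hweak _ hr _ hs0⟩
  apply le_antisymm
  · refine le_of_forall_pos_le_add fun ε hε => ?_
    obtain ⟨S, hS, hSε⟩ := kr_approx μ hμ (ε := ε / 4) (by linarith)
    obtain ⟨R, hR, hRε⟩ := kr_approx ν hν (ε := ε / 4) (by linarith)
    obtain ⟨w, hw, hw1, hw2, hwC⟩ := kr_fin (fun i : S.range => (i : EuclideanSpace ℝ (Fin n)))
      (fun i : R.range => (i : EuclideanSpace ℝ (Fin n)))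
      (fun i => μ.real (S ⁻¹' {(i : EuclideanSpace ℝ (Fin n))}))
      (fun i => ν.real (R ⁻¹' {(i : EuclideanSpace ℝ (Fin n))}))
      (fun _ => measureReal_nonneg) (fun _ => measureReal_nonneg)
      (by simpa using kr_integral_simple S μ (fun _ => 1))
      (by simpa using kr_integral_simple R ν (fun _ => 1)) (sSup D + ε / 2) (by
        intro ψ hψ
        rw [kr_integral_simple S μ ψ, kr_integral_simple R ν ψ]
        have h1 := abs_le.1 (kr_simple_bound μ hμ S hS ψ hψ)
        have h2 := abs_le.1 (kr_simple_bound ν hν R hR ψ hψ)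
        have h3 := le_csSup hDb
          (show _ ∈ D from ⟨ψ, hψ, kr_lip_int μ hμ ψ hψ, kr_lip_int ν hν ψ hψ, rfl⟩)
        linarith [h1.1, h1.2, h2.1, h2.2])
    obtain ⟨π, hπ1, hπ2, hπ⟩ := kr_glue μ ν S R w hw hw1 hw2
    have hprob : IsProbabilityMeasure π := by
      constructor
      rw [← measure_univ (μ := μ), ← hπ1, Measure.map_apply measurable_fst MeasurableSet.univ]
      simp
    refine (csInf_le hIb ⟨π, hprob, hπ1, hπ2, rfl⟩).trans ?_
    obtain ⟨i1, e1⟩ := hfst π hπ1 _ hS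
    obtain ⟨i2, e2⟩ := hsnd π hπ2 _ hR
    have i3 : Integrable (fun z : EuclideanSpace ℝ (Fin n) × EuclideanSpace ℝ (Fin n) =>
        ‖S z.1 - R z.2‖) π := by
      have h1 : Integrable (fun x => S x) μ := S.integrable_of_isFiniteMeasure
      have h2 : Integrable (fun x => R x) ν := R.integrable_of_isFiniteMeasure
      rw [← hπ1] at h1
      rw [← hπ2] at h2
      exact ((h1.comp_measurable measurable_fst).sub (h2.comp_measurable measurable_snd)).norm
    have : ∫ p, ‖p.1 - p.2‖ ∂π ≤ ∫ p, (‖p.1 - S p.1‖ + ‖S p.1 - R p.2‖ + ‖p.2 - R p.2‖) ∂π := by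
      refine integral_mono (hcost π hπ1 hπ2) ((i1.add i3).add i2) fun p => ?_
      have h1 := norm_sub_le_norm_sub_add_norm_sub p.1 (S p.1) p.2
      have h2 := norm_sub_le_norm_sub_add_norm_sub (S p.1) (R p.2) p.2
      rw [norm_sub_rev (R p.2) p.2] at h2
      simp only
      linarith
    have i13 : Integrable (fun p => ‖p.1 - S p.1‖ + ‖S p.1 - R p.2‖) π := i1.add i3
    rw [integral_add i13 i2, integral_add i1 i3, e1, e2, hπ] at this
    linarith
  · exact csSup_le ⟨r0, hr0⟩ fun r hr => le_csInf ⟨s0, hs0⟩ fun s hs => hweak r hr s hs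
end

section
/- Diagonal rescaling structure of the entropic optimum: let C ∈ ℝ^{k₁×k₂}, α > 0, and let v ∈ Δ_{k₁} and w ∈ Δ_{k₂} have strictly positive entries. If T* minimizes the entropic objective Σ_{ij} T_{ij} C_{ij} + α Σ_{ij} T_{ij} log T_{ij} (with the convention 0·log 0 = 0) over matrices T with nonnegative entries, row sums Σ_j T_{ij} = v_i, and column sums Σ_i T_{ij} = w_j, then all entries of T* are strictly positive and there exist strictly positive vectors p ∈ ℝ^{k₁} and q ∈ ℝ^{k₂} such that T*_{ij} = p_i · exp(−C_{ij}/α) · q_j for all (i,j). -/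
open Finset Real

def dlt {n : ℕ} (i i' a : Fin n) : ℝ := (if a = i then 1 else 0) - (if a = i' then 1 else 0)

lemma dlt_sum {n : ℕ} (i i' : Fin n) (f : Fin n → ℝ) : ∑ a, dlt i i' a * f a = f i - f i' := by
  simp [dlt, sub_mul, Finset.sum_sub_distrib]

lemma dlt_sum_one {n : ℕ} (i i' : Fin n) : ∑ a, dlt i i' a = 0 := by
  simpa using dlt_sum i i' (fun _ => 1)

lemma tangent_ineq (x y : ℝ) (hx : 0 ≤ x) (hy : 0 < y) :
    y * Real.log y - x * Real.log x ≤ (y - x) * (1 + Real.log y) := by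
  rcases hx.eq_or_lt with rfl | hx
  · simp; nlinarith
  · have h := Real.log_le_sub_one_of_pos (div_pos hy hx)
    rw [Real.log_div hy.ne' hx.ne'] at h
    have h2 := mul_le_mul_of_nonneg_left h hx.le
    have h3 : x * (y / x - 1) = y - x := by field_simp
    nlinarith

lemma swap_ineq
    (k₁ k₂ : ℕ) (C : Fin k₁ → Fin k₂ → ℝ) (α : ℝ) (hα : 0 < α)
    (v : Fin k₁ → ℝ) (w : Fin k₂ → ℝ)
    (T : Fin k₁ → Fin k₂ → ℝ)
    (hT0 : ∀ i j, 0 ≤ T i j)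
    (hTrow : ∀ i, ∑ j, T i j = v i)
    (hTcol : ∀ j, ∑ i, T i j = w j)
    (hmin : ∀ T' : Fin k₁ → Fin k₂ → ℝ,
      (∀ i j, 0 ≤ T' i j) → (∀ i, ∑ j, T' i j = v i) → (∀ j, ∑ i, T' i j = w j) →
      (∑ i, ∑ j, T i j * C i j) + α * ∑ i, ∑ j, T i j * Real.log (T i j)
        ≤ (∑ i, ∑ j, T' i j * C i j) + α * ∑ i, ∑ j, T' i j * Real.log (T' i j))
    (i i' : Fin k₁) (j j' : Fin k₂) (hi : i ≠ i') (hj : j ≠ j')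
    (ε : ℝ) (hε : 0 < ε) (hb : ε < T i j') (hc : ε < T i' j) :
    Real.exp (-(C i j + C i' j' - C i j' - C i' j) / α) * ((T i j' - ε) * (T i' j - ε))
      ≤ (T i j + ε) * (T i' j' + ε) := by
  set S : Fin k₁ → Fin k₂ → ℝ := fun a b => T a b + ε * (dlt i i' a * dlt j j' b) with hS
  have hcase : ∀ a b, 0 < S a b ∨ S a b = T a b := by
    intro a b
    have h0 := hT0 a b
    by_cases h1 : a = i <;> by_cases h2 : b = j <;> by_cases h3 : a = i' <;>
      by_cases h4 : b = j' <;> simp_all [dlt] <;> first | (left; linarith [hT0 i j, hT0 i' j']) | skip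
  have e1 : S i j = T i j + ε := by simp [hS, dlt, hi, hj]
  have e2 : S i' j' = T i' j' + ε := by simp [hS, dlt, hi.symm, hj.symm]
  have e3 : S i j' = T i j' - ε := by simp [hS, dlt, hi, hj.symm]; ring
  have e4 : S i' j = T i' j - ε := by simp [hS, dlt, hi.symm, hj]; ring
  have hm := hmin S
    (fun a b => by rcases hcase a b with h | h; exact h.le; rw [h]; exact hT0 a b)
    (fun a => by
      simp only [hS, Finset.sum_add_distrib, ← Finset.mul_sum, dlt_sum_one, hTrow]; simp)
    (fun b => by
      simp only [hS, Finset.sum_add_distrib, ← Finset.mul_sum, ← Finset.sum_mul, dlt_sum_one,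
        hTcol]; simp)
  have hpt : ∀ a b, (S a b * C a b + α * (S a b * Real.log (S a b)))
      - (T a b * C a b + α * (T a b * Real.log (T a b)))
      ≤ ε * (dlt i i' a * (dlt j j' b * (C a b + α * (1 + Real.log (S a b))))) := by
    intro a b
    have hd : ε * (dlt i i' a * dlt j j' b) = S a b - T a b := by simp [hS]
    have : ε * (dlt i i' a * (dlt j j' b * (C a b + α * (1 + Real.log (S a b)))))
        = (S a b - T a b) * (C a b + α * (1 + Real.log (S a b))) := by rw [← hd]; ring
    rw [this]
    rcases hcase a b with h | h
    · have := mul_le_mul_of_nonneg_left (tangent_ineq (T a b) (S a b) (hT0 a b) h) hα.le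
      nlinarith
    · rw [h]; simp
  have hsum := Finset.sum_le_sum (fun a (_ : a ∈ Finset.univ) =>
    Finset.sum_le_sum (fun b (_ : b ∈ Finset.univ) => hpt a b))
  simp only [← Finset.mul_sum, dlt_sum] at hsum
  simp only [Finset.sum_sub_distrib, Finset.sum_add_distrib, ← Finset.mul_sum] at hsum
  rw [e1, e2, e3, e4] at hsum
  have h0 : 0 ≤ ε * (C i j + α * (1 + Real.log (T i j + ε)) - (C i j' + α * (1 + Real.log (T i j' - ε)))
      - (C i' j + α * (1 + Real.log (T i' j - ε)) - (C i' j' + α * (1 + Real.log (T i' j' + ε))))) := by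
    linarith
  have h1 := nonneg_of_mul_nonneg_right h0 hε
  have p1 : 0 < T i j + ε := by linarith [hT0 i j]
  have p2 : 0 < T i' j' + ε := by linarith [hT0 i' j']
  have p3 : 0 < T i j' - ε := by linarith
  have p4 : 0 < T i' j - ε := by linarith
  rw [← Real.log_le_log_iff (by positivity) (by positivity),
    Real.log_mul (Real.exp_pos _).ne' (by positivity), Real.log_exp,
    Real.log_mul p3.ne' p4.ne', Real.log_mul p1.ne' p2.ne', ← le_sub_iff_add_le, div_le_iff₀ hα]
  linarith

lemma swap_limit (K a b c d : ℝ) (hb : 0 < b) (hc : 0 < c)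
    (h : ∀ ε, 0 < ε → ε < b → ε < c → K * ((b - ε) * (c - ε)) ≤ (a + ε) * (d + ε)) :
    K * (b * c) ≤ a * d := by
  have t1 : Filter.Tendsto (fun ε : ℝ => K * ((b - ε) * (c - ε))) (nhdsWithin 0 (Set.Ioi 0))
      (nhds (K * (b * c))) := by
    have : Continuous (fun ε : ℝ => K * ((b - ε) * (c - ε))) := by fun_prop
    simpa using (this.tendsto 0).mono_left nhdsWithin_le_nhds
  have t2 : Filter.Tendsto (fun ε : ℝ => (a + ε) * (d + ε)) (nhdsWithin 0 (Set.Ioi 0))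
      (nhds (a * d)) := by
    have : Continuous (fun ε : ℝ => (a + ε) * (d + ε)) := by fun_prop
    simpa using (this.tendsto 0).mono_left nhdsWithin_le_nhds
  refine le_of_tendsto_of_tendsto t1 t2 ?_
  filter_upwards [Ioo_mem_nhdsGT (lt_min hb hc)] with ε hε
  exact h ε hε.1 (hε.2.trans_le (min_le_left _ _)) (hε.2.trans_le (min_le_right _ _))

/-- Diagonal rescaling structure of the entropic optimum: the minimizer of the
entropically regularized transport problem (with strictly positive marginals)
has strictly positive entries and factors as `diag(p) · K_α · diag(q)`. -/
theorem entropic_optimum_diagonal_rescaling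
    (k₁ k₂ : ℕ) (C : Fin k₁ → Fin k₂ → ℝ) (α : ℝ) (hα : 0 < α)
    (v : Fin k₁ → ℝ) (w : Fin k₂ → ℝ)
    (hv : (∀ i, 0 < v i) ∧ ∑ i, v i = 1)
    (hw : (∀ j, 0 < w j) ∧ ∑ j, w j = 1)
    (T : Fin k₁ → Fin k₂ → ℝ)
    (hT0 : ∀ i j, 0 ≤ T i j)
    (hTrow : ∀ i, ∑ j, T i j = v i)
    (hTcol : ∀ j, ∑ i, T i j = w j)
    (hmin : ∀ T' : Fin k₁ → Fin k₂ → ℝ,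
      (∀ i j, 0 ≤ T' i j) → (∀ i, ∑ j, T' i j = v i) → (∀ j, ∑ i, T' i j = w j) →
      (∑ i, ∑ j, T i j * C i j) + α * ∑ i, ∑ j, T i j * Real.log (T i j)
        ≤ (∑ i, ∑ j, T' i j * C i j) + α * ∑ i, ∑ j, T' i j * Real.log (T' i j)) :
    (∀ i j, 0 < T i j) ∧
    ∃ (p : Fin k₁ → ℝ) (q : Fin k₂ → ℝ),
      (∀ i, 0 < p i) ∧ (∀ j, 0 < q j) ∧
      ∀ i j, T i j = p i * Real.exp (-C i j / α) * q j := by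
  have key : ∀ i i' j j', i ≠ i' → j ≠ j' → 0 < T i j' → 0 < T i' j →
      Real.exp (-(C i j + C i' j' - C i j' - C i' j) / α) * (T i j' * T i' j)
        ≤ T i j * T i' j' := fun i i' j j' hi hj hb hc =>
    swap_limit _ _ _ _ _ hb hc fun ε hε h1 h2 =>
      swap_ineq k₁ k₂ C α hα v w T hT0 hTrow hTcol hmin i i' j j' hi hj ε hε h1 h2
  have hpos : ∀ i j, 0 < T i j := by
    intro i j
    by_contra hn
    have hz : T i j = 0 := le_antisymm (not_lt.1 hn) (hT0 i j)
    obtain ⟨j', -, hj'⟩ : ∃ j' ∈ Finset.univ, 0 < T i j' :=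
      Finset.exists_lt_of_sum_lt (f := fun _ => (0 : ℝ)) (by simpa [hTrow] using hv.1 i)
    obtain ⟨i', -, hi'⟩ : ∃ i' ∈ Finset.univ, 0 < T i' j :=
      Finset.exists_lt_of_sum_lt (f := fun _ => (0 : ℝ)) (by simpa [hTcol] using hw.1 j)
    have hi : i ≠ i' := by rintro rfl; exact hn hi'
    have hj : j ≠ j' := by rintro rfl; exact hn hj'
    have := key i i' j j' hi hj hj' hi'
    rw [hz, zero_mul] at this
    exact absurd this (not_le.2 (by positivity))
  refine ⟨hpos, ?_⟩
  have keq : ∀ i i' j j', Real.exp (-(C i j + C i' j' - C i j' - C i' j) / α) * (T i j' * T i' j)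
        = T i j * T i' j' := by
    intro i i' j j'
    by_cases hi : i = i'
    · subst hi
      simp [mul_comm]
    by_cases hj : j = j'
    · subst hj
      simp
    apply le_antisymm (key i i' j j' hi hj (hpos _ _) (hpos _ _))
    have h := key i i' j' j hi (Ne.symm hj) (hpos _ _) (hpos _ _)
    have h2 := mul_le_mul_of_nonneg_left h
      (Real.exp_pos (-(C i j + C i' j' - C i j' - C i' j) / α)).le
    rw [← mul_assoc, ← Real.exp_add] at h2
    have h3 : -(C i j + C i' j' - C i j' - C i' j) / α + -(C i j' + C i' j - C i j - C i' j') / α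
        = 0 := by ring
    rwa [h3, Real.exp_zero, one_mul] at h2
  have hk1 : k₁ ≠ 0 := by rintro rfl; simp at hv
  have hk2 : k₂ ≠ 0 := by rintro rfl; simp at hw
  let i0 : Fin k₁ := ⟨0, Nat.pos_of_ne_zero hk1⟩
  let j0 : Fin k₂ := ⟨0, Nat.pos_of_ne_zero hk2⟩
  refine ⟨fun i => T i j0 * Real.exp (C i j0 / α),
    fun j => T i0 j * Real.exp (C i0 j / α) * Real.exp (-C i0 j0 / α) / T i0 j0,
    fun i => mul_pos (hpos _ _) (Real.exp_pos _),
    fun j => div_pos (mul_pos (mul_pos (hpos _ _) (Real.exp_pos _)) (Real.exp_pos _)) (hpos _ _),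
    fun i j => ?_⟩
  have h := keq i i0 j j0
  have hne := (hpos i0 j0).ne'
  rw [eq_comm, ← eq_div_iff hne] at h
  rw [h]
  have : Real.exp (-(C i j + C i0 j0 - C i j0 - C i0 j) / α)
      = Real.exp (C i j0 / α) * Real.exp (-C i j / α) * Real.exp (C i0 j / α)
        * Real.exp (-C i0 j0 / α) := by
    rw [← Real.exp_add, ← Real.exp_add, ← Real.exp_add]; congr 1; ring
  rw [this]
  ring
end

section
/- One-dimensional 1-Wasserstein distance via cumulative distribution functions: let μ and ν be Borel probability measures on ℝ with finite first moments. Then the infimum over all couplings π of μ and ν of ∫_{ℝ×ℝ} |x − y| dπ(x,y) equals ∫_{ℝ} |F_μ(t) − F_ν(t)| dt, where F_μ(t) := μ((−∞, t]) and F_ν(t) := ν((−∞, t]) are the cumulative distribution functions. -/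
open MeasureTheory

namespace W1Aux

lemma slice (π : Measure (ℝ × ℝ)) [IsProbabilityMeasure π] (t : ℝ) :
    π {p : ℝ × ℝ | min p.1 p.2 ≤ t ∧ t < max p.1 p.2}
      = ENNReal.ofReal ((π.map Prod.fst).real (Set.Iic t) + (π.map Prod.snd).real (Set.Iic t)
          - 2 * π.real (Set.Iic t ×ˢ Set.Iic t)) := by
  rw [map_measureReal_apply measurable_fst measurableSet_Iic,
    map_measureReal_apply measurable_snd measurableSet_Iic]
  have hX : MeasurableSet ((Prod.fst : ℝ × ℝ → ℝ) ⁻¹' Set.Iic t) :=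
    measurable_fst measurableSet_Iic
  have hY : MeasurableSet ((Prod.snd : ℝ × ℝ → ℝ) ⁻¹' Set.Iic t) :=
    measurable_snd measurableSet_Iic
  have h1 : {p : ℝ × ℝ | min p.1 p.2 ≤ t ∧ t < max p.1 p.2}
      = (Prod.fst ⁻¹' Set.Iic t ∪ Prod.snd ⁻¹' Set.Iic t) \ (Set.Iic t ×ˢ Set.Iic t) := by
    ext p
    simp only [Set.mem_ofPred_eq, Set.mem_sdiff, Set.mem_union, Set.mem_preimage, Set.mem_Iic,
      Set.mem_prod, min_le_iff, lt_max_iff, not_and_or, not_le]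
  have h2 : (Prod.fst ⁻¹' Set.Iic t ∩ Prod.snd ⁻¹' Set.Iic t : Set (ℝ × ℝ))
      = (Set.Iic t ×ˢ Set.Iic t) := by
    ext p; rfl
  have h3 := measureReal_union_add_inter (μ := π) (s := Prod.fst ⁻¹' Set.Iic t) hY
  rw [h2] at h3
  have h4 : π.real ((Prod.fst ⁻¹' Set.Iic t ∪ Prod.snd ⁻¹' Set.Iic t) \ (Set.Iic t ×ˢ Set.Iic t))
      = π.real (Prod.fst ⁻¹' Set.Iic t ∪ Prod.snd ⁻¹' Set.Iic t)
        - π.real (Set.Iic t ×ˢ Set.Iic t) := by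
    refine measureReal_sdiff ?_ (measurableSet_Iic.prod measurableSet_Iic)
    intro p hp
    exact Or.inl hp.1
  rw [h1, ← ofReal_measureReal, h4]
  congr 1
  linarith

lemma tonelli (π : Measure (ℝ × ℝ)) [IsProbabilityMeasure π] :
    ∫⁻ p, ENNReal.ofReal |p.1 - p.2| ∂π
      = ∫⁻ t, ENNReal.ofReal ((π.map Prod.fst).real (Set.Iic t)
          + (π.map Prod.snd).real (Set.Iic t) - 2 * π.real (Set.Iic t ×ˢ Set.Iic t)) := by
  set A : Set ((ℝ × ℝ) × ℝ) := {q | min q.1.1 q.1.2 ≤ q.2 ∧ q.2 < max q.1.1 q.1.2} with hA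
  have hAm : MeasurableSet A := by
    have b1 : MeasurableSet {q : (ℝ × ℝ) × ℝ | min q.1.1 q.1.2 ≤ q.2} :=
      measurableSet_le (by fun_prop) (by fun_prop)
    have b2 : MeasurableSet {q : (ℝ × ℝ) × ℝ | q.2 < max q.1.1 q.1.2} :=
      measurableSet_lt (by fun_prop) (by fun_prop)
    exact b1.inter b2
  have e1 := Measure.prod_apply (μ := π) (ν := (volume : Measure ℝ)) hAm
  rw [Measure.prod_apply_symm hAm] at e1
  have e2 : ∀ p : ℝ × ℝ, (volume : Measure ℝ) (Prod.mk p ⁻¹' A)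
      = ENNReal.ofReal |p.1 - p.2| := by
    intro p
    have : Prod.mk p ⁻¹' A = Set.Ico (min p.1 p.2) (max p.1 p.2) := rfl
    rw [this, Real.volume_Ico, max_sub_min_eq_abs']
  simp_rw [e2] at e1
  rw [← e1]
  exact lintegral_congr fun t => slice π t

lemma le_slice (π : Measure (ℝ × ℝ)) [IsProbabilityMeasure π] (t : ℝ) :
    |(π.map Prod.fst).real (Set.Iic t) - (π.map Prod.snd).real (Set.Iic t)|
      ≤ (π.map Prod.fst).real (Set.Iic t)
          + (π.map Prod.snd).real (Set.Iic t) - 2 * π.real (Set.Iic t ×ˢ Set.Iic t) := by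
  rw [map_measureReal_apply measurable_fst measurableSet_Iic,
    map_measureReal_apply measurable_snd measurableSet_Iic]
  have h1 : π.real (Set.Iic t ×ˢ Set.Iic t) ≤ π.real (Prod.fst ⁻¹' Set.Iic t) :=
    measureReal_mono fun p hp => hp.1
  have h2 : π.real (Set.Iic t ×ˢ Set.Iic t) ≤ π.real (Prod.snd ⁻¹' Set.Iic t) :=
    measureReal_mono fun p hp => hp.2
  rw [abs_le]
  constructor <;> linarith

noncomputable def Q (μ : Measure ℝ) (u : ℝ) : ℝ := sInf {x | u ≤ ProbabilityTheory.cdf μ x}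

lemma Q_le_iff (μ : Measure ℝ) {u : ℝ} (hu : u ∈ Set.Ioo (0:ℝ) 1) (t : ℝ) :
    Q μ u ≤ t ↔ u ≤ ProbabilityTheory.cdf μ t := by
  have hmono := ProbabilityTheory.monotone_cdf μ
  have hne : {x | u ≤ ProbabilityTheory.cdf μ x}.Nonempty := by
    obtain ⟨x, hx⟩ := ((ProbabilityTheory.tendsto_cdf_atTop μ).eventually_const_lt hu.2).exists
    exact ⟨x, hx.le⟩
  have hbdd : BddBelow {x | u ≤ ProbabilityTheory.cdf μ x} := by
    obtain ⟨x, hx⟩ := ((ProbabilityTheory.tendsto_cdf_atBot μ).eventually_lt_const hu.1).exists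
    refine ⟨x, fun y hy => ?_⟩
    by_contra! h
    exact absurd (hmono h.le) (not_le.2 (hx.trans_le hy))
  constructor
  · intro h
    have hr : Filter.Tendsto (ProbabilityTheory.cdf μ) (nhdsWithin t (Set.Ioi t))
        (nhds (ProbabilityTheory.cdf μ t)) :=
      ((ProbabilityTheory.cdf μ).right_continuous t).mono_left
        (nhdsWithin_mono _ Set.Ioi_subset_Ici_self)
    refine ge_of_tendsto hr ?_
    filter_upwards [self_mem_nhdsWithin] with s hs
    obtain ⟨x, hx, hxs⟩ := exists_lt_of_csInf_lt hne (h.trans_lt hs)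
    exact le_trans hx (hmono hxs.le)
  · intro h
    exact csInf_le hbdd h

lemma Q_aem (μ : Measure ℝ) : AEMeasurable (Q μ) (volume.restrict (Set.Ioo (0:ℝ) 1)) := by
  refine aemeasurable_restrict_of_monotoneOn measurableSet_Ioo ?_
  intro u hu v hv huv
  rw [Q_le_iff μ hu]
  exact huv.trans ((Q_le_iff μ hv _).1 le_rfl)

lemma vol_aux {c : ℝ} (h0 : 0 ≤ c) (h1 : c ≤ 1) :
    volume (Set.Iic c ∩ Set.Ioo (0:ℝ) 1) = ENNReal.ofReal c := by
  apply le_antisymm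
  · calc volume (Set.Iic c ∩ Set.Ioo (0:ℝ) 1) ≤ volume (Set.Ioc 0 c) := measure_mono fun x hx => ⟨hx.2.1, hx.1⟩
      _ = _ := by simp
  · calc ENNReal.ofReal c = volume (Set.Ioo 0 c) := by simp
      _ ≤ volume (Set.Iic c ∩ Set.Ioo (0:ℝ) 1) := measure_mono fun x hx => ⟨hx.2.le, hx.1, hx.2.trans_le h1⟩

lemma Q_pre (μ : Measure ℝ) (t : ℝ) :
    Q μ ⁻¹' Set.Iic t ∩ Set.Ioo (0:ℝ) 1
      = Set.Iic (ProbabilityTheory.cdf μ t) ∩ Set.Ioo (0:ℝ) 1 := by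
  ext u
  simp only [Set.mem_inter_iff, Set.mem_preimage, Set.mem_Iic]
  exact and_congr_left fun hu => Q_le_iff μ hu t

instance prob : IsProbabilityMeasure (volume.restrict (Set.Ioo (0:ℝ) 1)) := ⟨by simp⟩

lemma Q_map (μ : Measure ℝ) [IsProbabilityMeasure μ] :
    (volume.restrict (Set.Ioo (0:ℝ) 1)).map (Q μ) = μ := by
  have : IsProbabilityMeasure ((volume.restrict (Set.Ioo (0:ℝ) 1)).map (Q μ)) :=
    Measure.isProbabilityMeasure_map (Q_aem μ)
  refine Measure.ext_of_Iic _ _ fun t => ?_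
  rw [Measure.map_apply_of_aemeasurable (Q_aem μ) measurableSet_Iic,
    Measure.restrict_apply' measurableSet_Ioo, Q_pre,
    vol_aux (ProbabilityTheory.cdf_nonneg μ t) (ProbabilityTheory.cdf_le_one μ t),
    ProbabilityTheory.ofReal_cdf]

lemma exists_opt (μ ν : Measure ℝ) [IsProbabilityMeasure μ] [IsProbabilityMeasure ν] :
    ∃ π : Measure (ℝ × ℝ), IsProbabilityMeasure π ∧ π.map Prod.fst = μ ∧ π.map Prod.snd = ν ∧
      ∀ t, π.real (Set.Iic t ×ˢ Set.Iic t) = min (μ.real (Set.Iic t)) (ν.real (Set.Iic t)) := by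
  have hm : AEMeasurable (fun u => (Q μ u, Q ν u)) (volume.restrict (Set.Ioo (0:ℝ) 1)) :=
    (Q_aem μ).prodMk (Q_aem ν)
  refine ⟨(volume.restrict (Set.Ioo (0:ℝ) 1)).map (fun u => (Q μ u, Q ν u)),
    Measure.isProbabilityMeasure_map hm, ?_, ?_, fun t => ?_⟩
  · rw [AEMeasurable.map_map_of_aemeasurable measurable_fst.aemeasurable hm]
    exact Q_map μ
  · rw [AEMeasurable.map_map_of_aemeasurable measurable_snd.aemeasurable hm]
    exact Q_map ν
  · rw [← ProbabilityTheory.cdf_eq_real, ← ProbabilityTheory.cdf_eq_real, measureReal_def,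
      Measure.map_apply_of_aemeasurable hm (measurableSet_Iic.prod measurableSet_Iic),
      Measure.restrict_apply' measurableSet_Ioo]
    have h0 : 0 ≤ min (ProbabilityTheory.cdf μ t) (ProbabilityTheory.cdf ν t) :=
      le_min (ProbabilityTheory.cdf_nonneg μ t) (ProbabilityTheory.cdf_nonneg ν t)
    have : (fun u => (Q μ u, Q ν u)) ⁻¹' (Set.Iic t ×ˢ Set.Iic t) ∩ Set.Ioo (0:ℝ) 1
        = Set.Iic (min (ProbabilityTheory.cdf μ t) (ProbabilityTheory.cdf ν t))
          ∩ Set.Ioo (0:ℝ) 1 := by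
      ext u
      simp only [Set.mem_inter_iff, Set.mem_preimage, Set.mem_Iic, Set.mem_prod, le_min_iff]
      exact and_congr_left fun hu => and_congr (Q_le_iff μ hu t) (Q_le_iff ν hu t)
    rw [this, vol_aux h0 ((min_le_left _ _).trans (ProbabilityTheory.cdf_le_one μ t)),
      ENNReal.toReal_ofReal h0]

lemma F_meas (μ : Measure ℝ) [IsProbabilityMeasure μ] :
    Measurable fun t => μ.real (Set.Iic t) := by
  refine Monotone.measurable fun s t hst => ?_
  exact measureReal_mono (Set.Iic_subset_Iic.2 hst)

end W1Aux

open W1Aux in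
/-- The one-dimensional 1-Wasserstein distance equals the L¹ distance between
cumulative distribution functions. -/
theorem w1_one_dim_eq_cdf_l1
    (μ ν : Measure ℝ) [IsProbabilityMeasure μ] [IsProbabilityMeasure ν]
    (hμ : Integrable (fun x => |x|) μ) (hν : Integrable (fun y => |y|) ν) :
    sInf {r : ℝ | ∃ π : Measure (ℝ × ℝ),
        IsProbabilityMeasure π ∧ π.map Prod.fst = μ ∧ π.map Prod.snd = ν ∧
        r = ∫ p, |p.1 - p.2| ∂π}
      = ∫ t, |(μ (Set.Iic t)).toReal - (ν (Set.Iic t)).toReal| := by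
  have hF : (∫ t, |(μ (Set.Iic t)).toReal - (ν (Set.Iic t)).toReal|)
      = (∫⁻ t, ENNReal.ofReal |μ.real (Set.Iic t) - ν.real (Set.Iic t)|).toReal := by
    refine integral_eq_lintegral_of_nonneg_ae (Filter.Eventually.of_forall fun t => abs_nonneg _) ?_
    have := ((F_meas μ).sub (F_meas ν)).abs
    exact this.aestronglyMeasurable
  have hP : ∀ π : Measure (ℝ × ℝ), ∫ p, |p.1 - p.2| ∂π
      = (∫⁻ p, ENNReal.ofReal |p.1 - p.2| ∂π).toReal := by
    intro π
    refine integral_eq_lintegral_of_nonneg_ae (Filter.Eventually.of_forall fun t => abs_nonneg _) ?_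
    exact (by fun_prop : Continuous fun p : ℝ × ℝ => |p.1 - p.2|).aestronglyMeasurable
  rw [hF]
  apply IsLeast.csInf_eq
  constructor
  · obtain ⟨π, hπ, h1, h2, h3⟩ := exists_opt μ ν
    refine ⟨π, hπ, h1, h2, ?_⟩
    rw [hP, tonelli, h1, h2]
    congr 1
    refine lintegral_congr fun t => ?_
    rw [h3, ← max_sub_min_eq_abs']
    congr 1
    linarith [min_add_max (μ.real (Set.Iic t)) (ν.real (Set.Iic t))]
  · rintro r ⟨π, hπ, h1, h2, rfl⟩
    rw [hP]
    refine ENNReal.toReal_mono ?_ ?_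
    · have a1 : Integrable (fun p : ℝ × ℝ => |p.1|) π := by
        rw [← h1] at hμ
        exact hμ.comp_measurable measurable_fst
      have a2 : Integrable (fun p : ℝ × ℝ => |p.2|) π := by
        rw [← h2] at hν
        exact hν.comp_measurable measurable_snd
      have a3 : Integrable (fun p : ℝ × ℝ => |p.1 - p.2|) π := by
        refine (a1.add a2).mono' ?_ (Filter.Eventually.of_forall fun p => ?_)
        · exact (by fun_prop : Continuous fun p : ℝ × ℝ => |p.1 - p.2|).aestronglyMeasurable
        · simpa using abs_sub p.1 p.2
      exact a3.lintegral_lt_top.ne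
    · rw [tonelli, ← h1, ← h2]
      exact lintegral_mono fun t => ENNReal.ofReal_le_ofReal (le_slice π t)
end

section
/- Triangle inequality for the p-Wasserstein distance, p ≥ 1: let (M, d) be a complete separable metric space equipped with its Borel σ-algebra, let p ≥ 1 be a real number, and for Borel probability measures μ, ν on M define W_p(μ,ν) := (inf over couplings π of μ and ν of ∫_{M×M} d(x,y)^p dπ(x,y))^{1/p}, valued in [0,∞]. Then for all Borel probability measures μ, ν, ρ on M, W_p(μ,ρ) ≤ W_p(μ,ν) + W_p(ν,ρ). -/
open MeasureTheory

/-- The p-Wasserstein "distance" (valued in `ℝ≥0∞`) on Borel probability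
measures over a metric space. -/
noncomputable def wassersteinDist {M : Type*} [MetricSpace M] [MeasurableSpace M]
    (p : ℝ) (μ ν : Measure M) : ENNReal :=
  (⨅ (π : Measure (M × M)) (_ : IsProbabilityMeasure π ∧
        π.map Prod.fst = μ ∧ π.map Prod.snd = ν),
      ∫⁻ q, ENNReal.ofReal (dist q.1 q.2 ^ p) ∂π) ^ (1 / p)

open ProbabilityTheory

lemma wd_eq {M : Type*} [MetricSpace M] [MeasurableSpace M]
    (p : ℝ) (hp : 1 ≤ p) (μ ν : Measure M) : wassersteinDist p μ ν =
  ⨅ (π : Measure (M × M)) (_ : IsProbabilityMeasure π ∧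
        π.map Prod.fst = μ ∧ π.map Prod.snd = ν),
      (∫⁻ q, (edist q.1 q.2) ^ p ∂π) ^ (1 / p) := by
  have h0 : 0 < p := by linarith
  have hp' : 0 < 1 / p := by positivity
  unfold wassersteinDist
  have := fun (P : Prop) (f : P → ENNReal) => (ENNReal.orderIsoRpow (1/p) hp').map_iInf f
  simp only [ENNReal.orderIsoRpow_apply] at this
  have h2 := fun (f : Measure (M × M) → ENNReal) => (ENNReal.orderIsoRpow (1/p) hp').map_iInf f
  simp only [ENNReal.orderIsoRpow_apply] at h2
  rw [h2]
  refine iInf_congr fun π => ?_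
  rw [this]
  simp_rw [edist_dist, ENNReal.ofReal_rpow_of_nonneg dist_nonneg h0.le]

lemma glue {M : Type*} [MeasurableSpace M] [StandardBorelSpace M]
    (π₁ π₂ : Measure (M × M)) [IsProbabilityMeasure π₁] [IsProbabilityMeasure π₂]
    (h : π₁.map Prod.snd = π₂.map Prod.fst) :
    ∃ γ : Measure ((M × M) × M), IsProbabilityMeasure γ ∧ γ.map Prod.fst = π₁ ∧
      γ.map (fun q => (q.1.2, q.2)) = π₂ := by
  have hne : Nonempty (M × M) := nonempty_of_isProbabilityMeasure π₁
  have : Nonempty M := ⟨hne.some.1⟩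
  refine ⟨π₁ ⊗ₘ (π₂.condKernel.comap Prod.snd measurable_snd), inferInstance,
    Measure.fst_compProd _ _, ?_⟩
  conv_rhs => rw [← π₂.disintegrate π₂.condKernel]
  ext s hs
  have hm : Measurable (fun q : (M × M) × M => (q.1.2, q.2)) := by fun_prop
  rw [Measure.map_apply hm hs, Measure.compProd_apply (hm hs), Measure.compProd_apply hs,
    Measure.fst, ← h, lintegral_map (Kernel.measurable_kernel_prodMk_left hs) measurable_snd]
  rfl

/-- Triangle inequality for the p-Wasserstein distance, p ≥ 1, on a complete
separable metric space with its Borel σ-algebra. -/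
theorem wasserstein_triangle_inequality
    {M : Type*} [MetricSpace M] [CompleteSpace M] [TopologicalSpace.SeparableSpace M]
    [MeasurableSpace M] [BorelSpace M]
    (p : ℝ) (hp : 1 ≤ p)
    (μ ν ρ : Measure M)
    [IsProbabilityMeasure μ] [IsProbabilityMeasure ν] [IsProbabilityMeasure ρ] :
    wassersteinDist p μ ρ ≤ wassersteinDist p μ ν + wassersteinDist p ν ρ := by
  have h0 : 0 < p := by linarith
  have : SecondCountableTopology M := UniformSpace.secondCountable_of_separable M
  have : PolishSpace M := inferInstance
  have : StandardBorelSpace M := inferInstance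
  simp only [wd_eq p hp]
  simp_rw [ENNReal.iInf_add, ENNReal.add_iInf]
  refine le_iInf fun π₁ => le_iInf fun ⟨i1, a1, b1⟩ => le_iInf fun π₂ => le_iInf fun ⟨i2, a2, b2⟩ => ?_
  obtain ⟨γ, ig, hg1, hg2⟩ := glue π₁ π₂ (b1.trans a2.symm)
  have hm : Measurable (fun q : (M × M) × M => (q.1.2, q.2)) := by fun_prop
  have hm3 : Measurable (fun q : (M × M) × M => (q.1.1, q.2)) := by fun_prop
  have hd : Measurable (fun q : M × M => edist q.1 q.2 ^ p) := by fun_prop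
  refine (iInf₂_le (γ.map (fun q => (q.1.1, q.2)))
    ⟨Measure.isProbabilityMeasure_map hm3.aemeasurable, ?_, ?_⟩).trans ?_
  rotate_left 1
  · rw [Measure.map_map measurable_fst hm3, ← a1, ← hg1, Measure.map_map measurable_fst measurable_fst]
    rfl
  · rw [Measure.map_map measurable_snd hm3, ← b2, ← hg2, Measure.map_map measurable_snd hm]
    rfl
  · rw [← hg1, ← hg2, lintegral_map hd hm3, lintegral_map hd hm, lintegral_map hd measurable_fst]
    refine le_trans ?_ (ENNReal.lintegral_Lp_add_le (μ := γ)
      (f := fun q => edist q.1.1 q.1.2) (g := fun q => edist q.1.2 q.2) (by fun_prop) (by fun_prop) hp)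
    gcongr
    exact edist_triangle _ _ _
end
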